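/- Let φ : ℝ₊ → ℝ₊ be increasing (t1 ≤ t2 implies φ(t1) ≤ φ(t2)) and right upper semicontinuous (for every t0 ≥ 0, limsup_{t→t0+} φ(t) ≤ φ(t0)). Then the following are equivalent: (a) the iterates φⁿ(t) → 0 as n → ∞ for every t > 0; (b) φ(t) < t for every t > 0. -/

import Mathlib

open Filter Topology Set

/-- Let `φ : ℝ₊ → ℝ₊` (modelled as `φ : ℝ → ℝ` mapping nonnegatives to
nonnegatives) be increasing on `[0, ∞)` and right upper semicontinuous at every `t₀ ≥ 0`
(`limsup_{t → t₀⁺} φ t ≤ φ t₀`). Then the iterates `φⁿ t → 0` for every `t > 0` iff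
`φ t < t` for every `t > 0`. -/
theorem stmt19 (φ : ℝ → ℝ)
    (hmap : ∀ t : ℝ, 0 ≤ t → 0 ≤ φ t)
    (hmono : ∀ t₁ t₂ : ℝ, 0 ≤ t₁ → t₁ ≤ t₂ → φ t₁ ≤ φ t₂)
    (husc : ∀ t₀ : ℝ, 0 ≤ t₀ → limsup φ (𝓝[>] t₀) ≤ φ t₀) :
    (∀ t : ℝ, 0 < t → Tendsto (fun n : ℕ => φ^[n] t) atTop (𝓝 0)) ↔
      (∀ t : ℝ, 0 < t → φ t < t) := by
  constructor
  · intro h t ht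
    by_contra! hle
    have hge : ∀ n : ℕ, t ≤ φ^[n] t := by
      intro n
      induction n with
      | zero => simp
      | succ k ih =>
        rw [Function.iterate_succ_apply']
        exact hle.trans (hmono _ _ ht.le ih)
    exact absurd (ge_of_tendsto' (h t ht) hge) (not_le.mpr ht)
  · intro h t ht
    have hnonneg : ∀ n : ℕ, 0 ≤ φ^[n] t := by
      intro n
      induction n with
      | zero => simpa using ht.le
      | succ k ih =>
        rw [Function.iterate_succ_apply']
        exact hmap _ ih
    have hzero : φ 0 ≤ 0 := by
      refine le_of_forall_pos_le_add fun ε hε => ?_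
      rw [zero_add]
      exact (hmono 0 ε le_rfl hε.le).trans (h ε hε).le
    have hle : ∀ s : ℝ, 0 ≤ s → φ s ≤ s := by
      intro s hs
      rcases hs.eq_or_lt with rfl | hs
      · exact hzero
      · exact (h s hs).le
    have hanti : Antitone fun n : ℕ => φ^[n] t := by
      refine antitone_nat_of_succ_le fun n => ?_
      rw [Function.iterate_succ_apply']
      exact hle _ (hnonneg n)
    have hbdd : BddBelow (range fun n : ℕ => φ^[n] t) :=
      ⟨0, by rintro _ ⟨n, rfl⟩; exact hnonneg n⟩
    have hlim := tendsto_atTop_ciInf hanti hbdd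
    have hL : ∀ n : ℕ, (⨅ n : ℕ, φ^[n] t) ≤ φ^[n] t := fun n => ciInf_le hbdd n
    have hL0 : 0 ≤ ⨅ n : ℕ, φ^[n] t := le_ciInf hnonneg
    generalize (⨅ n : ℕ, φ^[n] t) = L at hlim hL hL0
    rcases hL0.eq_or_lt with rfl | hLpos
    · exact hlim
    · exfalso
      have hbound : IsBoundedUnder (· ≤ ·) (𝓝[>] L) φ := by
        refine ⟨φ (L + 1), ?_⟩
        rw [eventually_map]
        filter_upwards [Ioo_mem_nhdsGT (lt_add_one L)] with s hs
        exact hmono _ _ (hL0.trans hs.1.le) hs.2.le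
      have hright : ∀ᶠ s in 𝓝[>] L, φ s < L :=
        eventually_lt_of_limsup_lt ((husc L hL0).trans_lt (h L hLpos)) hbound
      have hnhds : ∀ᶠ s in 𝓝 L, L < s → φ s < L := eventually_nhdsWithin_iff.mp hright
      obtain ⟨n, hn⟩ := (hlim.eventually hnhds).exists
      have hlt : φ (φ^[n] t) < L := by
        rcases (hL n).eq_or_lt with heq | hlt
        · rw [← heq]
          exact h L hLpos
        · exact hn hlt
      rw [← Function.iterate_succ_apply' φ n t] at hlt
      exact absurd (hL (n + 1)) (not_le.mpr hlt)
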